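/- arXiv:1610.00226 — 2 statements merged into one kernel-verified Lean document; each statement's English description precedes it below -/
import Mathlib

section
/- The sum over all finite abelian p-groups G of 1/|Aut(G)| equals 1/∏_{i=1}^∞ (1 - p^{-i}). -/
/-- The finite abelian `p`-group corresponding to a list of exponents `l`,
namely `∏ i, ZMod (p ^ l i)`.  By the classification of finite abelian
`p`-groups, as `l` ranges over partitions these exhaust all isomorphism
classes exactly once. -/
def pGroupOfList (p : ℕ) (l : List ℕ) : Type :=
  ∀ i : Fin l.length, ZMod (p ^ l.get i)

noncomputable instance (p : ℕ) (l : List ℕ) : AddCommGroup (pGroupOfList p l) := by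
  unfold pGroupOfList; infer_instance


open scoped ENNReal

theorem CL.index_prod {A : Type*} [AddCommGroup A] (L : AddSubgroup (ℤ × A)) :
    L.index = (L.comap (AddMonoidHom.inr ℤ A)).index * (L.map (AddMonoidHom.fst ℤ A)).index := by
  have hr : (AddMonoidHom.fst ℤ A).range = ⊤ := AddMonoidHom.range_eq_top.2 Prod.fst_surjective
  have hk : (AddMonoidHom.fst ℤ A).ker = (AddMonoidHom.inr ℤ A).range := by
    ext ⟨a, b⟩
    constructor
    · intro h
      have : a = 0 := h
      exact ⟨b, by simp [this]⟩
    · rintro ⟨c, hc⟩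
      have := congrArg Prod.fst hc
      exact this.symm
  rw [AddSubgroup.index_comap, AddSubgroup.index_map, hr, AddSubgroup.index_top, mul_one, hk,
    ← AddSubgroup.relIndex_sup_left, AddSubgroup.relIndex_mul_index le_sup_left]

/-- The lattice in `ℤ × A` attached to a sublattice, an exponent and a class. -/
def CL.lat {A : Type*} [AddCommGroup A] (L : AddSubgroup A) (a : A ⧸ L) (d : ℤ) :
    AddSubgroup (ℤ × A) where
  carrier := {x | ∃ c : ℤ, x.1 = c * d ∧ (QuotientAddGroup.mk x.2 : A ⧸ L) = c • a}
  zero_mem' := ⟨0, by simp⟩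
  add_mem' := by
    rintro ⟨x, y⟩ ⟨z, w⟩ ⟨c, h1, h2⟩ ⟨c', h3, h4⟩
    refine ⟨c + c', ?_, ?_⟩
    · simp only at h1 h3; simp [h1, h3]; ring
    · simp only at h2 h4; simp [h2, h4, add_smul]
  neg_mem' := by
    rintro ⟨x, y⟩ ⟨c, h1, h2⟩
    refine ⟨-c, ?_, ?_⟩
    · simp only at h1; simp [h1]
    · simp only at h2; simp [h2]

theorem CL.mem_lat {A : Type*} [AddCommGroup A] (L : AddSubgroup A) (a : A ⧸ L) (d : ℤ)
    (x : ℤ × A) : x ∈ CL.lat L a d ↔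
      ∃ c : ℤ, x.1 = c * d ∧ (QuotientAddGroup.mk x.2 : A ⧸ L) = c • a := Iff.rfl

theorem CL.lat_comap {A : Type*} [AddCommGroup A] (L : AddSubgroup A) (a : A ⧸ L) (d : ℤ)
    (hd : d ≠ 0) : (CL.lat L a d).comap (AddMonoidHom.inr ℤ A) = L := by
  ext x
  rw [AddSubgroup.mem_comap, CL.mem_lat]
  constructor
  · rintro ⟨c, h1, h2⟩
    have : c = 0 := by simpa [hd, eq_comm] using h1
    subst this
    simpa using h2
  · intro h
    exact ⟨0, by simp, by simpa using h⟩

theorem CL.lat_map {A : Type*} [AddCommGroup A] (L : AddSubgroup A) (a : A ⧸ L) (d : ℤ) :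
    (CL.lat L a d).map (AddMonoidHom.fst ℤ A) = AddSubgroup.zmultiples d := by
  ext x
  rw [AddSubgroup.mem_map, AddSubgroup.mem_zmultiples_iff]
  constructor
  · rintro ⟨y, ⟨c, h1, h2⟩, rfl⟩
    exact ⟨c, by simp [h1]⟩
  · rintro ⟨c, rfl⟩
    obtain ⟨b, hb⟩ := QuotientAddGroup.mk_surjective (c • a)
    exact ⟨(c * d, b), ⟨c, rfl, hb⟩, by simp⟩

theorem CL.lat_index {A : Type*} [AddCommGroup A] (L : AddSubgroup A) (a : A ⧸ L) (d : ℤ)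
    (hd : d ≠ 0) : (CL.lat L a d).index = L.index * d.natAbs := by
  rw [CL.index_prod, CL.lat_comap _ _ _ hd, CL.lat_map, Int.index_zmultiples]

theorem CL.eq_lat {A : Type*} [AddCommGroup A] (M : AddSubgroup (ℤ × A)) (d : ℤ) (hd : d ≠ 0)
    (hM : M.map (AddMonoidHom.fst ℤ A) = AddSubgroup.zmultiples d) :
    ∃ a, CL.lat (M.comap (AddMonoidHom.inr ℤ A)) a d = M := by
  have : d ∈ M.map (AddMonoidHom.fst ℤ A) := by rw [hM]; exact AddSubgroup.mem_zmultiples d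
  obtain ⟨⟨d', b⟩, hb, h⟩ := this
  obtain rfl : d' = d := h
  refine ⟨QuotientAddGroup.mk b, ?_⟩
  have key : ∀ c : ℤ, ∀ y : A, (QuotientAddGroup.mk y : A ⧸ (M.comap (AddMonoidHom.inr ℤ A))) =
      c • QuotientAddGroup.mk b ↔ (c * d', y) ∈ M := by
    intro c y
    rw [← QuotientAddGroup.mk_zsmul, eq_comm, QuotientAddGroup.eq, AddSubgroup.mem_comap,
      ← M.add_mem_cancel_left (M.zsmul_mem hb c)]
    simp
  ext ⟨x, y⟩
  rw [CL.mem_lat]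
  constructor
  · rintro ⟨c, h1, h2⟩
    rw [key] at h2
    simp only at h1
    rwa [h1]
  · intro h
    have : x ∈ M.map (AddMonoidHom.fst ℤ A) := ⟨_, h, rfl⟩
    rw [hM, AddSubgroup.mem_zmultiples_iff] at this
    obtain ⟨c, rfl⟩ := this
    exact ⟨c, by simp, (key c y).2 (by simpa using h)⟩

/-- Sublattices of `p`-power index. -/
abbrev CL.Lat (p : ℕ) (A : Type*) [AddCommGroup A] : Type _ :=
  {L : AddSubgroup A // ∃ k : ℕ, L.index = p ^ k}

/-- The lattice sum. -/
noncomputable def CL.S (p n : ℕ) (A : Type*) [AddCommGroup A] : ℝ≥0∞ :=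
  ∑' L : CL.Lat p A, ((L.1.index : ℝ≥0∞) ^ n)⁻¹

theorem CL.S_congr (p n : ℕ) {A B : Type*} [AddCommGroup A] [AddCommGroup B] (e : A ≃+ B) :
    CL.S p n A = CL.S p n B := by
  let E : CL.Lat p A ≃ CL.Lat p B := (e.mapAddSubgroup.toEquiv).subtypeEquiv (by
    intro L
    have : (e.mapAddSubgroup.toEquiv L).index = L.index := AddSubgroup.index_map_equiv L e
    rw [this])
  unfold CL.S
  rw [← E.tsum_eq]
  refine tsum_congr fun L => ?_
  have : (E L).1.index = L.1.index := AddSubgroup.index_map_equiv L.1 e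
  rw [this]

/-- The parametrisation of sublattices. -/
noncomputable def CL.param (p : ℕ) (hp : p.Prime) (A : Type*) [AddCommGroup A] 
    (x : Σ L : CL.Lat p A, (A ⧸ L.1) × ℕ) : CL.Lat p (ℤ × A) :=
  ⟨CL.lat x.1.1 x.2.1 ((p : ℤ) ^ x.2.2), by
    obtain ⟨⟨L, k, hk⟩, a, i⟩ := x
    refine ⟨k + i, ?_⟩
    rw [CL.lat_index _ _ _ (by simp [hp.ne_zero])]
    simp [Int.natAbs_pow, hk, pow_add]⟩

theorem CL.param_bij (p : ℕ) (hp : p.Prime) (A : Type*) [AddCommGroup A] :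
    Function.Bijective (CL.param p hp A) := by
  have hp0 : ∀ i : ℕ, (p : ℤ) ^ i ≠ 0 := fun i => by simp [hp.ne_zero]
  constructor
  · rintro ⟨⟨L, hL⟩, a, i⟩ ⟨⟨L', hL'⟩, a', i'⟩ h
    have h0 : CL.lat L a ((p : ℤ) ^ i) = CL.lat L' a' ((p : ℤ) ^ i') := congrArg Subtype.val h
    have h1 : L = L' := by
      rw [← CL.lat_comap L a _ (hp0 i), h0, CL.lat_comap _ _ _ (hp0 i')]
    subst h1
    have h2 := congrArg (fun M => (M.map (AddMonoidHom.fst ℤ A)).index) h0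
    simp only [CL.lat_map, Int.index_zmultiples, Int.natAbs_pow, Int.natAbs_natCast] at h2
    have h3 : i = i' := Nat.pow_right_injective hp.two_le h2
    subst h3
    obtain ⟨b, rfl⟩ := QuotientAddGroup.mk_surjective a
    have h4 : (((p : ℤ) ^ i, b) : ℤ × A) ∈ CL.lat L (QuotientAddGroup.mk b) ((p : ℤ) ^ i) :=
      ⟨1, by simp, by simp⟩
    rw [h0] at h4
    obtain ⟨c, h5, h6⟩ := h4
    have : c = 1 := by
      have := hp0 i
      simp only at h5
      exact (mul_left_eq_self₀.1 h5.symm).resolve_right this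
    subst this
    simp only [one_smul] at h6
    rw [h6]
  · rintro ⟨M, k, hk⟩
    have h := CL.index_prod M
    rw [hk] at h
    obtain ⟨i, -, hi⟩ := (Nat.dvd_prime_pow hp).1 (Dvd.intro _ h.symm)
    obtain ⟨j, -, hj⟩ := (Nat.dvd_prime_pow hp).1 (Dvd.intro_left _ h.symm)
    have hM : M.map (AddMonoidHom.fst ℤ A) = AddSubgroup.zmultiples ((p : ℤ) ^ j) := by
      obtain ⟨d, hd⟩ := Int.subgroup_cyclic (M.map (AddMonoidHom.fst ℤ A))
      rw [← AddSubgroup.zmultiples_eq_closure] at hd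
      rw [hd, Int.index_zmultiples] at hj
      rw [hd, ← Int.zmultiples_natAbs, hj]
      simp
    obtain ⟨a, ha⟩ := CL.eq_lat M _ (hp0 j) hM
    exact ⟨⟨⟨_, i, hi⟩, a, j⟩, Subtype.ext ha⟩

theorem CL.S_succ (p n : ℕ) (hp : p.Prime) (A : Type*) [AddCommGroup A] :
    CL.S p (n + 1) (ℤ × A) = CL.S p n A * (1 - ((p : ℝ≥0∞)⁻¹) ^ (n + 1))⁻¹ := by
  unfold CL.S
  rw [← (Equiv.ofBijective _ (CL.param_bij p hp A)).tsum_eq, ENNReal.tsum_sigma',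
    ← ENNReal.tsum_mul_right]
  refine tsum_congr fun L => ?_
  rw [ENNReal.tsum_prod']
  have h1 : ∀ (a : A ⧸ L.1) (i : ℕ), (((((Equiv.ofBijective _ (CL.param_bij p hp A))
      ⟨L, a, i⟩ : CL.Lat p (ℤ × A)).1.index : ℕ) : ℝ≥0∞) ^ (n + 1))⁻¹ =
      ((L.1.index : ℝ≥0∞) ^ (n + 1))⁻¹ * (((p : ℝ≥0∞)⁻¹) ^ (n + 1)) ^ i := by
    intro a i
    have : ((Equiv.ofBijective _ (CL.param_bij p hp A))
      ⟨L, a, i⟩ : CL.Lat p (ℤ × A)).1.index = L.1.index * p ^ i := by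
      have := CL.lat_index L.1 a ((p : ℤ) ^ i) (by simp [hp.ne_zero])
      simpa [Int.natAbs_pow, CL.param] using this
    rw [this]
    push_cast
    rw [mul_pow, ENNReal.mul_inv (Or.inr (by finiteness)) (Or.inl (by finiteness)), ENNReal.inv_pow, ENNReal.inv_pow, ENNReal.inv_pow,
      ← pow_mul, ← pow_mul, mul_comm i]
  simp_rw [h1, ENNReal.tsum_mul_left, ENNReal.tsum_geometric]
  obtain ⟨k, hk⟩ := L.2
  have hne : L.1.index ≠ 0 := by rw [hk]; exact pow_ne_zero _ hp.ne_zero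
  have : L.1.FiniteIndex := ⟨hne⟩
  have : Finite (A ⧸ L.1) := AddSubgroup.finite_quotient_of_finiteIndex
  have := Fintype.ofFinite (A ⧸ L.1)
  have hc : Fintype.card (A ⧸ L.1) = L.1.index := by rw [AddSubgroup.index, Nat.card_eq_fintype_card]
  rw [tsum_fintype, Finset.sum_const, Finset.card_univ, hc, nsmul_eq_mul, ← mul_assoc]
  congr 1
  rw [pow_succ, ENNReal.mul_inv (Or.inr (by finiteness)) (Or.inl (by finiteness)), mul_comm, mul_left_comm,
    ENNReal.mul_inv_cancel (by exact_mod_cast hne) (by finiteness), mul_one]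

theorem CL.S_fin (p n : ℕ) (hp : p.Prime) :
    CL.S p n (Fin n → ℤ) = ∏ i ∈ Finset.range n, (1 - ((p : ℝ≥0∞)⁻¹) ^ (i + 1))⁻¹ := by
  induction n with
  | zero =>
    have : Unique (CL.Lat p (Fin 0 → ℤ)) :=
      { default := ⟨⊤, 0, by simp⟩
        uniq := fun L => Subtype.ext (Subsingleton.elim _ _) }
    unfold CL.S
    simp
  | succ n ih =>
    rw [Finset.prod_range_succ, ← ih, ← CL.S_succ p n hp]
    exact CL.S_congr p (n + 1) (Fin.consLinearEquiv ℤ (fun _ : Fin (n + 1) => ℤ)).symm.toAddEquiv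

/-- Definitional unfolding of `pGroupOfList`. -/
noncomputable def CL.unf (p : ℕ) (l : List ℕ) :
    pGroupOfList p l ≃+ (∀ i : Fin l.length, ZMod (p ^ l.get i)) where
  toFun x := x
  invFun x := x
  left_inv _ := rfl
  right_inv _ := rfl
  map_add' _ _ := rfl

theorem CL.finite (p : ℕ) (hp : p.Prime) (l : List ℕ) : Finite (pGroupOfList p l) := by
  have : ∀ i : Fin l.length, NeZero (p ^ l.get i) := fun i => ⟨pow_ne_zero _ hp.ne_zero⟩
  exact Finite.of_equiv _ (CL.unf p l).symm.toEquiv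

theorem CL.card (p : ℕ) (l : List ℕ) : Nat.card (pGroupOfList p l) = p ^ l.sum := by
  rw [Nat.card_congr (CL.unf p l).toEquiv, Nat.card_pi]
  simp only [Nat.card_zmod]
  rw [Finset.prod_pow_eq_pow_sum]
  congr 1
  simp [← List.sum_ofFn]

theorem CL.exists_equiv {ι κ : Type} [Fintype ι] [Fintype κ] (e : ι → ℕ) (f : κ → ℕ)
    (h : Finset.univ.val.map e = Finset.univ.val.map f) : ∃ σ : ι ≃ κ, ∀ i, f (σ i) = e i := by
  have key : ∀ v : ℕ, Nonempty ({i // e i = v} ≃ {i // f i = v}) := by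
    intro v
    have := congrArg (Multiset.count v) h
    rw [Multiset.count_map, Multiset.count_map] at this
    refine Fintype.card_eq.1 ?_
    rw [Fintype.card_subtype, Fintype.card_subtype]
    simpa [Finset.card, eq_comm] using this
  have F := fun v => (key v).some
  refine ⟨(Equiv.sigmaFiberEquiv e).symm.trans ((Equiv.sigmaCongrRight F).trans
    (Equiv.sigmaFiberEquiv f)), fun i => ?_⟩
  exact (F (e i) ⟨i, rfl⟩).2

theorem CL.equiv_of_multiset (p : ℕ) {ι : Type} [Fintype ι] (e : ι → ℕ) (l : List ℕ)
    (h : Finset.univ.val.map e = (l : Multiset ℕ)) :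
    Nonempty ((∀ i, ZMod (p ^ e i)) ≃+ pGroupOfList p l) := by
  obtain ⟨σ, hσ⟩ := CL.exists_equiv e l.get (by
    rw [h]; simp)
  obtain rfl : (fun i => l.get (σ i)) = e := funext hσ
  exact ⟨(LinearEquiv.piCongrLeft ℤ (fun k => ZMod (p ^ l.get k)) σ).toAddEquiv.trans
    (CL.unf p l).symm⟩

theorem CL.exists_partition (p : ℕ) (hp : p.Prime) (G : Type*) [AddCommGroup G] (k : ℕ)
    (hG : Nat.card G = p ^ k) :
    ∃ π : Σ n : ℕ, n.Partition, Nonempty (G ≃+ pGroupOfList p π.2.parts.toList) := by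
  have : Finite G := Nat.finite_of_card_ne_zero (by rw [hG]; exact pow_ne_zero _ hp.ne_zero)
  obtain ⟨ι, _, n, hn, ⟨E⟩⟩ := AddCommGroup.equiv_directSum_zmod_of_finite' G
  have E' : G ≃+ ∀ i, ZMod (n i) := E.trans (DirectSum.addEquivProd _)
  have hc : p ^ k = ∏ i, n i := by
    rw [← hG, Nat.card_congr E'.toEquiv, Nat.card_pi]; simp
  have h1 : ∀ i, ∃ e, n i = p ^ e := fun i => by
    obtain ⟨e, -, he⟩ := (Nat.dvd_prime_pow hp).1 (hc ▸ Finset.dvd_prod_of_mem n (Finset.mem_univ i))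
    exact ⟨e, he⟩
  choose e he using h1
  obtain rfl : n = fun i => p ^ e i := funext he
  have hpos : ∀ i, 0 < e i := fun i => by
    rcases Nat.eq_zero_or_pos (e i) with h | h
    · have := hn i; simp [h] at this
    · exact h
  let P : (Finset.univ.val.map e).sum.Partition :=
    { parts := Finset.univ.val.map e
      parts_pos := by
        intro i hi
        obtain ⟨j, -, rfl⟩ := Multiset.mem_map.1 hi
        exact hpos j
      parts_sum := rfl }
  obtain ⟨E2⟩ := CL.equiv_of_multiset p e P.parts.toList (by simp [P])
  exact ⟨⟨_, P⟩, ⟨E'.trans E2⟩⟩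

theorem CL.card_tors (p : ℕ) (hp : p.Prime) (l : List ℕ) (k : ℕ) :
    Nat.card {x : pGroupOfList p l // p ^ k • x = 0} = p ^ (l.map (min · k)).sum := by
  have : ∀ i : Fin l.length, NeZero (p ^ l.get i) := fun i => ⟨pow_ne_zero _ hp.ne_zero⟩
  have E : {x : pGroupOfList p l // p ^ k • x = 0} ≃
      ∀ i : Fin l.length, {x : ZMod (p ^ l.get i) // p ^ k • x = 0} :=
    ((CL.unf p l).toEquiv.subtypeEquiv (q := fun x => ∀ i, p ^ k • x i = 0) (by
      intro x
      rw [← (CL.unf p l).map_eq_zero_iff, map_nsmul, funext_iff]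
      rfl)).trans
      (Equiv.subtypePiEquivPi (p := fun i (x : ZMod (p ^ l.get i)) => p ^ k • x = 0))
  rw [Nat.card_congr E, Nat.card_pi]
  have h : ∀ i : Fin l.length, Nat.card {x : ZMod (p ^ l.get i) // p ^ k • x = 0} =
      p ^ min (l.get i) k := by
    intro i
    have := IsAddCyclic.card_nsmulAddMonoidHom_ker (G := ZMod (p ^ l.get i)) (p ^ k)
    rw [Nat.card_zmod] at this
    refine Eq.trans ?_ (this.trans ?_)
    · rfl
    · rcases le_total (l.get i) k with h | h
      · rw [min_eq_left h, Nat.gcd_eq_left (pow_dvd_pow p h)]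
      · rw [min_eq_right h, Nat.gcd_eq_right (pow_dvd_pow p h)]
  simp only [h]
  rw [Finset.prod_pow_eq_pow_sum]
  congr 1
  rw [← List.sum_ofFn]
  congr 1
  apply List.ext_get <;> simp

theorem CL.sum_min (s : Multiset ℕ) (k : ℕ) :
    (s.map (min · (k + 1))).sum = (s.map (min · k)).sum + s.countP (k < ·) := by
  induction s using Multiset.induction with
  | empty => simp
  | cons a s ih =>
    rw [Multiset.map_cons, Multiset.map_cons, Multiset.sum_cons, Multiset.sum_cons, ih,
      Multiset.countP_cons]
    split_ifs <;> omega

theorem CL.countP_count (s : Multiset ℕ) (k : ℕ) :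
    s.countP (k < ·) = s.countP (k + 1 < ·) + s.count (k + 1) := by
  induction s using Multiset.induction with
  | empty => simp
  | cons a s ih =>
    rw [Multiset.countP_cons, Multiset.countP_cons, Multiset.count_cons, ih]
    split_ifs <;> omega

theorem CL.partition_unique (p : ℕ) (hp : p.Prime) (π π' : Σ n : ℕ, n.Partition)
    (e : pGroupOfList p π.2.parts.toList ≃+ pGroupOfList p π'.2.parts.toList) : π = π' := by
  have h1 : ∀ k, (π.2.parts.map (min · k)).sum = (π'.2.parts.map (min · k)).sum := by
    intro k
    have h := CL.card_tors p hp π.2.parts.toList k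
    have h' := CL.card_tors p hp π'.2.parts.toList k
    have E : {x : pGroupOfList p π.2.parts.toList // p ^ k • x = 0} ≃
        {x : pGroupOfList p π'.2.parts.toList // p ^ k • x = 0} :=
      e.toEquiv.subtypeEquiv (by
        intro x
        rw [← e.map_eq_zero_iff, map_nsmul]
        rfl)
    rw [Nat.card_congr E, h'] at h
    have h2 := (Nat.pow_right_injective hp.two_le h).symm
    rw [← Multiset.sum_coe, ← Multiset.sum_coe, ← Multiset.map_coe, ← Multiset.map_coe,
      Multiset.coe_toList, Multiset.coe_toList] at h2
    exact h2
  have h2 : ∀ k, π.2.parts.countP (k < ·) = π'.2.parts.countP (k < ·) := by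
    intro k
    have a := CL.sum_min π.2.parts k
    have b := CL.sum_min π'.2.parts k
    rw [h1, h1] at a
    omega
  have h3 : π.2.parts = π'.2.parts := by
    ext v
    rcases v with _ | k
    · rw [Multiset.count_eq_zero_of_notMem, Multiset.count_eq_zero_of_notMem]
      · intro h; exact absurd (π'.2.parts_pos h) (lt_irrefl _)
      · intro h; exact absurd (π.2.parts_pos h) (lt_irrefl _)
    · have a := CL.countP_count π.2.parts k
      have b := CL.countP_count π'.2.parts k
      rw [h2, h2] at a
      omega
  obtain ⟨n, P⟩ := π
  obtain ⟨n', P'⟩ := π'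
  have : n = n' := by
    rw [← P.parts_sum, ← P'.parts_sum]; exact congrArg _ h3
  subst this
  congr 1
  exact Nat.Partition.ext h3

/-- Surjective homomorphisms. -/
abbrev CL.Sur (A G : Type*) [AddCommGroup A] [AddCommGroup G] : Type _ :=
  {f : A →+ G // Function.Surjective f}

theorem CL.equiv_of_ker {A G H : Type*} [AddCommGroup A] [AddCommGroup G] [AddCommGroup H]
    (f : A →+ G) (g : A →+ H) (hf : Function.Surjective f) (hg : Function.Surjective g)
    (h : f.ker = g.ker) : ∃ e : G ≃+ H, ∀ a, e (f a) = g a := by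
  refine ⟨(QuotientAddGroup.quotientKerEquivOfSurjective f hf).symm.trans
    ((QuotientAddGroup.quotientAddEquivOfEq h).trans
      (QuotientAddGroup.quotientKerEquivOfSurjective g hg)), fun a => ?_⟩
  have : (QuotientAddGroup.quotientKerEquivOfSurjective f hf).symm (f a) = QuotientAddGroup.mk a := by
    rw [AddEquiv.symm_apply_eq]; rfl
  simp only [AddEquiv.trans_apply, this]
  rfl

theorem CL.index_ker {A G : Type*} [AddCommGroup A] [AddCommGroup G]
    (f : A →+ G) (hf : Function.Surjective f) : f.ker.index = Nat.card G := by
  rw [AddSubgroup.index_ker, AddMonoidHom.range_eq_top.2 hf]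
  exact Nat.card_congr AddSubgroup.topEquiv.toEquiv

/-- The partition group. -/
abbrev CL.G (p : ℕ) (π : Σ n : ℕ, n.Partition) : Type := pGroupOfList p π.2.parts.toList

/-- The kernel as a lattice. -/
noncomputable def CL.K (p : ℕ) (A : Type*) [AddCommGroup A]
    (x : Σ π : Σ n : ℕ, n.Partition, CL.Sur A (CL.G p π)) : CL.Lat p A :=
  ⟨x.2.1.ker, _, (CL.index_ker x.2.1 x.2.2).trans (CL.card p _)⟩

theorem CL.aut_finite (p : ℕ) (hp : p.Prime) (π : Σ n : ℕ, n.Partition) :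
    Finite (AddAut (CL.G p π)) := by
  have := CL.finite p hp π.2.parts.toList
  exact Finite.of_injective (fun (e : AddAut (CL.G p π)) => (e : CL.G p π → CL.G p π))
    DFunLike.coe_injective

theorem CL.fiber_equiv (p : ℕ) (hp : p.Prime) (A : Type*) [AddCommGroup A] (L : CL.Lat p A) :
    ∃ π, Nonempty (AddAut (CL.G p π) ≃ {x // CL.K p A x = L}) ∧
      ∀ x : {x // CL.K p A x = L}, x.1.1 = π := by
  obtain ⟨k, hk⟩ := L.2
  obtain ⟨π, ⟨E⟩⟩ := CL.exists_partition p hp (A ⧸ L.1) k hk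
  let f₀ : A →+ CL.G p π := E.toAddMonoidHom.comp (QuotientAddGroup.mk' L.1)
  have hf₀ : Function.Surjective f₀ := E.surjective.comp (QuotientAddGroup.mk'_surjective L.1)
  have hk₀ : f₀.ker = L.1 := by
    ext a
    simp [f₀]
  have huniq : ∀ x : {x // CL.K p A x = L}, x.1.1 = π := by
    rintro ⟨⟨π', f⟩, h⟩
    have h' : f.1.ker = f₀.ker := by rw [hk₀]; exact congrArg Subtype.val h
    obtain ⟨e, -⟩ := CL.equiv_of_ker f.1 f₀ f.2 hf₀ h'
    exact CL.partition_unique p hp _ _ e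
  refine ⟨π, ⟨Equiv.ofBijective (fun α => ⟨⟨π, ⟨(AddEquiv.toAddMonoidHom α).comp f₀,
    (AddEquiv.surjective α).comp hf₀⟩⟩, ?_⟩) ⟨?_, ?_⟩⟩, huniq⟩
  · apply Subtype.ext
    rw [← hk₀]
    ext a
    simp only [CL.K, AddMonoidHom.mem_ker, AddMonoidHom.comp_apply]
    exact AddEquiv.map_eq_zero_iff α
  · intro α β h
    have h1 := congrArg Subtype.val h
    simp only [Sigma.mk.injEq, heq_eq_eq, true_and] at h1
    have h2 := congrArg Subtype.val h1
    apply AddEquiv.ext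
    intro y
    obtain ⟨a, rfl⟩ := hf₀ y
    exact DFunLike.congr_fun h2 a
  · rintro ⟨⟨π', f⟩, h⟩
    obtain rfl : π' = π := huniq ⟨⟨π', f⟩, h⟩
    have h' : f₀.ker = f.1.ker := by rw [hk₀]; exact (congrArg Subtype.val h).symm
    obtain ⟨e, he⟩ := CL.equiv_of_ker f₀ f.1 hf₀ f.2 h'
    refine ⟨e, ?_⟩
    apply Subtype.ext
    simp only [Sigma.mk.injEq, heq_eq_eq, true_and]
    apply Subtype.ext
    ext a
    exact he a

theorem CL.sum_eq_S (p n : ℕ) (hp : p.Prime) (A : Type*) [AddCommGroup A] :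
    ∑' π : Σ n : ℕ, n.Partition, (Nat.card (AddAut (CL.G p π)) : ℝ≥0∞)⁻¹ *
      ∑' _f : CL.Sur A (CL.G p π), ((Nat.card (CL.G p π) : ℝ≥0∞) ^ n)⁻¹ = CL.S p n A := by
  simp_rw [← ENNReal.tsum_mul_left]
  rw [← ENNReal.tsum_sigma' (fun x : Σ π : Σ n : ℕ, n.Partition, CL.Sur A (CL.G p π) =>
    (Nat.card (AddAut (CL.G p x.1)) : ℝ≥0∞)⁻¹ * ((Nat.card (CL.G p x.1) : ℝ≥0∞) ^ n)⁻¹),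
    ← (Equiv.sigmaFiberEquiv (CL.K p A)).tsum_eq, ENNReal.tsum_sigma']
  unfold CL.S
  refine tsum_congr fun L => ?_
  obtain ⟨π, ⟨E⟩, hπ⟩ := CL.fiber_equiv p hp A L
  have hfin := CL.aut_finite p hp π
  have := Fintype.ofFinite (AddAut (CL.G p π))
  have hcard : Nat.card (CL.G p π) = L.1.index := by
    obtain ⟨y, hy⟩ := E (AddEquiv.refl _)
    have h2 : y.1 = π := hπ ⟨y, hy⟩
    rw [← h2, ← hy]
    exact (CL.index_ker _ y.2.2).symm
  have h3 : ∀ y : {x // CL.K p A x = L},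
      (Nat.card (AddAut (CL.G p ((Equiv.sigmaFiberEquiv (CL.K p A)) ⟨L, y⟩).1)) : ℝ≥0∞)⁻¹ *
      ((Nat.card (CL.G p ((Equiv.sigmaFiberEquiv (CL.K p A)) ⟨L, y⟩).1) : ℝ≥0∞) ^ n)⁻¹ =
      (Nat.card (AddAut (CL.G p π)) : ℝ≥0∞)⁻¹ * ((L.1.index : ℝ≥0∞) ^ n)⁻¹ := by
    intro y
    have : ((Equiv.sigmaFiberEquiv (CL.K p A)) ⟨L, y⟩).1 = π := hπ y
    rw [this, hcard]
  rw [tsum_congr h3, ← E.tsum_eq, tsum_fintype, Finset.sum_const, Finset.card_univ, nsmul_eq_mul,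
    ← mul_assoc, Nat.card_eq_fintype_card, ENNReal.mul_inv_cancel, one_mul]
  · exact_mod_cast Fintype.card_ne_zero
  · finiteness

/-- Generating tuples. -/
abbrev CL.Gen (n : ℕ) (G : Type*) [AddCommGroup G] : Type _ :=
  {g : Fin n → G // Submodule.span ℤ (Set.range g) = ⊤}

theorem CL.sur_equiv_gen (n : ℕ) (G : Type*) [AddCommGroup G] :
    Nonempty (CL.Sur (Fin n → ℤ) G ≃ CL.Gen n G) := by
  let b := Pi.basisFun ℤ (Fin n)
  have key : ∀ f : (Fin n → ℤ) →+ G, b.constr ℤ (fun i => f (b i)) = f.toIntLinearMap :=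
    fun f => b.ext fun i => by rw [b.constr_basis]; rfl
  let E : ((Fin n → ℤ) →+ G) ≃ (Fin n → G) :=
    { toFun := fun f i => f (b i)
      invFun := fun g => (b.constr ℤ g).toAddMonoidHom
      left_inv := fun f => AddMonoidHom.ext fun x => DFunLike.congr_fun (key f) x
      right_inv := fun g => funext fun i => b.constr_basis ℤ g i }
  refine ⟨E.subtypeEquiv fun f => ?_⟩
  rw [← Module.Basis.constr_range b (S := ℤ)]
  change _ ↔ LinearMap.range (b.constr ℤ (fun i => f (b i))) = ⊤
  rw [key, LinearMap.range_eq_top]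
  exact Iff.rfl

theorem CL.gen_succ (n : ℕ) (G : Type*) [AddCommGroup G] [Finite G] :
    Nat.card (CL.Gen n G) * Nat.card G ≤ Nat.card (CL.Gen (n + 1) G) := by
  rw [← Nat.card_prod]
  refine Nat.card_le_card_of_injective (fun x : CL.Gen n G × G =>
    (⟨Fin.cons x.2 x.1.1, ?_⟩ : CL.Gen (n + 1) G)) ?_
  · rw [Fin.range_cons, eq_top_iff]
    refine x.1.2.symm.le.trans ?_
    exact Submodule.span_mono (Set.subset_insert _ _)
  · rintro ⟨⟨g, hg⟩, x⟩ ⟨⟨g', hg'⟩, x'⟩ h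
    have h1 := congrArg Subtype.val h
    simp only [Fin.cons_inj] at h1
    obtain ⟨rfl, rfl⟩ := h1
    rfl

theorem CL.gen_bound (n : ℕ) (G : Type*) [AddCommGroup G] [Finite G] :
    2 ^ n * Nat.card G ^ n ≤ 2 ^ n * Nat.card (CL.Gen n G) +
      Nat.card (Submodule ℤ G) * Nat.card G ^ n := by
  classical
  have := Fintype.ofFinite G
  have : Finite (Submodule ℤ G) := Finite.of_injective _ SetLike.coe_injective
  have := Fintype.ofFinite (Submodule ℤ G)
  have h1 : Nat.card G ^ n = Nat.card (CL.Gen n G) +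
      Nat.card {g : Fin n → G // ¬ Submodule.span ℤ (Set.range g) = ⊤} := by
    rw [← Nat.card_sum, Nat.card_congr (Equiv.sumCompl _), Nat.card_fun]
    simp
  have h2 : Nat.card {g : Fin n → G // ¬ Submodule.span ℤ (Set.range g) = ⊤} ≤
      Nat.card (Σ H : {H : Submodule ℤ G // H ≠ ⊤}, (Fin n → H.1)) := by
    refine Nat.card_le_card_of_injective (fun g => ⟨⟨Submodule.span ℤ (Set.range g.1), g.2⟩,
      fun i => ⟨g.1 i, Submodule.subset_span ⟨i, rfl⟩⟩⟩) ?_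
    intro g g' h
    let F : (Σ H : {H : Submodule ℤ G // H ≠ ⊤}, (Fin n → H.1)) → (Fin n → G) :=
      fun x i => (x.2 i : G)
    exact Subtype.ext (congrArg F h)
  have h3 : ∀ H : {H : Submodule ℤ G // H ≠ ⊤}, 2 ^ n * Nat.card (Fin n → H.1) ≤ Nat.card G ^ n := by
    intro H
    rw [Nat.card_fun, Nat.card_eq_fintype_card (α := Fin n), Fintype.card_fin, ← mul_pow]
    refine Nat.pow_le_pow_left ?_ n
    have h4 := AddSubgroup.card_mul_index H.1.toAddSubgroup
    have h5 : H.1.toAddSubgroup.index ≠ 1 := by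
      intro h
      rw [AddSubgroup.index_eq_one] at h
      apply H.2
      rw [← Submodule.toAddSubgroup_inj, h]
      rfl
    have h6 : H.1.toAddSubgroup.index ≠ 0 := AddSubgroup.index_ne_zero_of_finite
    have h7 : Nat.card H.1 * H.1.toAddSubgroup.index = Nat.card G := h4
    rw [← h7, mul_comm]
    exact Nat.mul_le_mul_left _ (by omega)
  have h8 : 2 ^ n * Nat.card (Σ H : {H : Submodule ℤ G // H ≠ ⊤}, (Fin n → H.1)) ≤
      Nat.card (Submodule ℤ G) * Nat.card G ^ n := by
    rw [Nat.card_sigma, Finset.mul_sum]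
    refine (Finset.sum_le_card_nsmul _ _ _ fun H _ => h3 H).trans ?_
    rw [smul_eq_mul]
    refine Nat.mul_le_mul_right _ ?_
    rw [Finset.card_univ, ← Nat.card_eq_fintype_card]
    exact Nat.card_le_card_of_injective _ Subtype.val_injective
  calc 2 ^ n * Nat.card G ^ n = 2 ^ n * Nat.card (CL.Gen n G) + 2 ^ n *
      Nat.card {g : Fin n → G // ¬ Submodule.span ℤ (Set.range g) = ⊤} := by rw [h1, mul_add]
    _ ≤ _ := Nat.add_le_add_left ((Nat.mul_le_mul_left _ h2).trans h8) _

/-- Proportion of generating tuples. -/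
noncomputable def CL.u (G : Type*) [AddCommGroup G] (n : ℕ) : ℝ≥0∞ :=
  ∑' _f : CL.Sur (Fin n → ℤ) G, ((Nat.card G : ℝ≥0∞) ^ n)⁻¹

theorem CL.u_eq (G : Type*) [AddCommGroup G] [Finite G] (n : ℕ) :
    CL.u G n = Nat.card (CL.Gen n G) * ((Nat.card G : ℝ≥0∞) ^ n)⁻¹ := by
  obtain ⟨E⟩ := CL.sur_equiv_gen n G
  have := Fintype.ofFinite (CL.Gen n G)
  rw [CL.u, ← E.symm.tsum_eq, tsum_fintype, Finset.sum_const, Finset.card_univ, nsmul_eq_mul,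
    Nat.card_eq_fintype_card (α := CL.Gen n G)]

theorem CL.u_mono (G : Type*) [AddCommGroup G] [Finite G] : Monotone (CL.u G) := by
  refine monotone_nat_of_le_succ fun n => ?_
  have h0 : (Nat.card G : ℝ≥0∞) ≠ 0 := by exact_mod_cast Nat.card_pos.ne'
  have h1 : (Nat.card G : ℝ≥0∞) ≠ ∞ := by finiteness
  rw [CL.u_eq, CL.u_eq]
  calc (Nat.card (CL.Gen n G) : ℝ≥0∞) * ((Nat.card G : ℝ≥0∞) ^ n)⁻¹
      = (Nat.card (CL.Gen n G) * Nat.card G : ℝ≥0∞) * ((Nat.card G : ℝ≥0∞) ^ (n + 1))⁻¹ := by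
        rw [pow_succ, ENNReal.mul_inv (Or.inr h1) (Or.inr h0), mul_assoc,
          mul_comm ((Nat.card G : ℝ≥0∞) ^ n)⁻¹, ← mul_assoc (Nat.card G : ℝ≥0∞),
          ENNReal.mul_inv_cancel h0 h1, one_mul]
    _ ≤ _ := by
        gcongr
        exact_mod_cast CL.gen_succ n G

theorem CL.u_le (G : Type*) [AddCommGroup G] [Finite G] (n : ℕ) : CL.u G n ≤ 1 := by
  have h0 : (Nat.card G : ℝ≥0∞) ≠ 0 := by exact_mod_cast Nat.card_pos.ne'
  have h1 : (Nat.card G : ℝ≥0∞) ≠ ∞ := by finiteness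
  rw [CL.u_eq, ← ENNReal.mul_inv_cancel (pow_ne_zero n h0) (ENNReal.pow_ne_top h1)]
  gcongr
  have : Nat.card (CL.Gen n G) ≤ Nat.card G ^ n := by
    refine (Nat.card_le_card_of_injective _ Subtype.val_injective).trans ?_
    rw [Nat.card_fun]; simp
  exact_mod_cast this

theorem CL.u_sup (G : Type*) [AddCommGroup G] [Finite G] : ⨆ n, CL.u G n = 1 := by
  have h0 : (Nat.card G : ℝ≥0∞) ≠ 0 := by exact_mod_cast Nat.card_pos.ne'
  have h1 : (Nat.card G : ℝ≥0∞) ≠ ∞ := by finiteness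
  refine le_antisymm (iSup_le (CL.u_le G)) ?_
  have key : ∀ n, (1 : ℝ≥0∞) ≤ (⨆ n, CL.u G n) + Nat.card (Submodule ℤ G) * (2⁻¹ : ℝ≥0∞) ^ n := by
    intro n
    refine le_trans ?_ (add_le_add_left (le_iSup (CL.u G) n) _)
    have hb : ((2 : ℝ≥0∞) ^ n * (Nat.card G : ℝ≥0∞) ^ n) ≤ 2 ^ n * Nat.card (CL.Gen n G) +
      Nat.card (Submodule ℤ G) * (Nat.card G : ℝ≥0∞) ^ n := by exact_mod_cast CL.gen_bound n G
    have a0 := pow_ne_zero n h0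
    have a1 := ENNReal.pow_ne_top (n := n) h1
    have b0 : (2 : ℝ≥0∞) ^ n ≠ 0 := pow_ne_zero n two_ne_zero
    have b1 : (2 : ℝ≥0∞) ^ n ≠ ∞ := by finiteness
    rw [CL.u_eq, ← ENNReal.inv_pow (a := 2)]
    set a := (Nat.card G : ℝ≥0∞) ^ n
    set b := (2 : ℝ≥0∞) ^ n
    calc (1 : ℝ≥0∞) = (b * a) * (b⁻¹ * a⁻¹) := by
          rw [mul_mul_mul_comm, ENNReal.mul_inv_cancel a0 a1, ENNReal.mul_inv_cancel b0 b1, one_mul]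
      _ ≤ (b * Nat.card (CL.Gen n G) + Nat.card (Submodule ℤ G) * a) * (b⁻¹ * a⁻¹) := by gcongr
      _ = (b * b⁻¹) * (Nat.card (CL.Gen n G) * a⁻¹) +
          (a * a⁻¹) * (Nat.card (Submodule ℤ G) * b⁻¹) := by ring
      _ = _ := by
          rw [ENNReal.mul_inv_cancel a0 a1, ENNReal.mul_inv_cancel b0 b1, one_mul, one_mul]
  have : Finite (Submodule ℤ G) := Finite.of_injective _ SetLike.coe_injective
  have ht : Filter.Tendsto (fun n : ℕ => (⨆ n, CL.u G n) + Nat.card (Submodule ℤ G) *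
      (2⁻¹ : ℝ≥0∞) ^ n) Filter.atTop (nhds ((⨆ n, CL.u G n) + Nat.card (Submodule ℤ G) * 0)) := by
    refine tendsto_const_nhds.add (ENNReal.Tendsto.const_mul ?_ (Or.inr (by finiteness)))
    exact ENNReal.tendsto_pow_atTop_nhds_zero_of_lt_one (by simp)
  rw [mul_zero, add_zero] at ht
  exact ge_of_tendsto' ht key

theorem CL.tsum_iSup {α : Type*} (c : α → ℝ≥0∞) (f : α → ℕ → ℝ≥0∞) (hf : ∀ a, Monotone (f a)) :
    ∑' a, c a * ⨆ n, f a n = ⨆ n, ∑' a, c a * f a n := by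
  simp_rw [ENNReal.mul_iSup, ENNReal.tsum_eq_iSup_sum]
  rw [iSup_comm]
  refine iSup_congr fun s => ?_
  exact ENNReal.finsetSum_iSup_of_monotone fun a i j h => mul_le_mul_right (hf a h) _

theorem CL.main_ennreal (p : ℕ) (hp : p.Prime) :
    ∑' π : Σ n : ℕ, n.Partition, (Nat.card (AddAut (CL.G p π)) : ℝ≥0∞)⁻¹ =
      ENNReal.ofReal (∏' i : ℕ, (1 - ((p : ℝ))⁻¹ ^ (i + 1)))⁻¹ := by
  have hfin : ∀ π, Finite (CL.G p π) := fun π => CL.finite p hp _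
  have h1 : ∑' π : Σ n : ℕ, n.Partition, (Nat.card (AddAut (CL.G p π)) : ℝ≥0∞)⁻¹ =
      ⨆ n, ∑' π : Σ n : ℕ, n.Partition, (Nat.card (AddAut (CL.G p π)) : ℝ≥0∞)⁻¹ *
        CL.u (CL.G p π) n := by
    rw [← CL.tsum_iSup _ _ fun π => CL.u_mono _]
    simp_rw [CL.u_sup, mul_one]
  have hmono : Monotone fun n => ∑' π : Σ n : ℕ, n.Partition,
      (Nat.card (AddAut (CL.G p π)) : ℝ≥0∞)⁻¹ * CL.u (CL.G p π) n :=
    fun i j h => ENNReal.tsum_le_tsum fun π => mul_le_mul_right (CL.u_mono _ h) _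
  have ht := tendsto_atTop_iSup hmono
  rw [← h1] at ht
  refine tendsto_nhds_unique ht ?_
  have hp1 : (1 : ℝ) < p := by exact_mod_cast hp.one_lt
  have hq0 : (0 : ℝ) < (p : ℝ)⁻¹ := by positivity
  have hq1 : (p : ℝ)⁻¹ < 1 := inv_lt_one_of_one_lt₀ hp1
  have hlt : ∀ i : ℕ, (p : ℝ)⁻¹ ^ (i + 1) < 1 := fun i => pow_lt_one₀ hq0.le hq1 (by omega)
  have hsum : Summable fun i : ℕ => ‖-((p : ℝ)⁻¹ ^ (i + 1))‖ := by
    simp_rw [norm_neg, norm_pow, Real.norm_of_nonneg hq0.le]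
    exact (summable_nat_add_iff 1).2 (summable_geometric_of_lt_one hq0.le hq1)
  have hmul : Multipliable fun i : ℕ => (1 - ((p : ℝ))⁻¹ ^ (i + 1)) := by
    simpa only [sub_eq_add_neg] using multipliable_one_add_of_summable hsum
  have hne : ∏' i : ℕ, (1 - ((p : ℝ))⁻¹ ^ (i + 1)) ≠ 0 := by
    have := tprod_one_add_ne_zero_of_summable (f := fun i : ℕ => -((p : ℝ)⁻¹ ^ (i + 1)))
      (fun i => by have := hlt i; linarith) hsum
    simpa only [sub_eq_add_neg] using this
  have h3 : Filter.Tendsto (fun n => ENNReal.ofReal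
      (∏ i ∈ Finset.range n, (1 - ((p : ℝ))⁻¹ ^ (i + 1)))⁻¹) Filter.atTop
      (nhds (ENNReal.ofReal (∏' i : ℕ, (1 - ((p : ℝ))⁻¹ ^ (i + 1)))⁻¹)) :=
    ENNReal.tendsto_ofReal (hmul.hasProd.tendsto_prod_nat.inv₀ hne)
  refine h3.congr fun n => ?_
  have h4 := CL.sum_eq_S p n hp (Fin n → ℤ)
  rw [CL.S_fin p n hp] at h4
  refine Eq.trans ?_ h4.symm
  rw [← Finset.prod_inv_distrib, ENNReal.ofReal_prod_of_nonneg]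
  · refine Finset.prod_congr rfl fun i _ => ?_
    rw [ENNReal.ofReal_inv_of_pos (by have := hlt i; linarith),
      ENNReal.ofReal_sub _ (by positivity), ENNReal.ofReal_one, ENNReal.ofReal_pow hq0.le,
      ENNReal.ofReal_inv_of_pos (by linarith), ENNReal.ofReal_natCast]
  · intro i _
    have := hlt i
    exact inv_nonneg.2 (by linarith)

/-- The sum over all isomorphism classes of finite abelian `p`-groups `G`
(indexed by partitions) of `1/|Aut G|` equals `1/∏_{i=1}^∞ (1 - p^{-i})`. -/
theorem sum_inv_card_aut_eq (p : ℕ) (hp : p.Prime) :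
    ∑' π : Σ n : ℕ, n.Partition,
        (1 : ℝ) / Nat.card (AddAut (pGroupOfList p π.2.parts.toList)) =
      (∏' i : ℕ, (1 - ((p : ℝ))⁻¹ ^ (i + 1)))⁻¹ := by
  have h := congrArg ENNReal.toReal (CL.main_ennreal p hp)
  have h0 : 0 ≤ (∏' i : ℕ, (1 - ((p : ℝ))⁻¹ ^ (i + 1)))⁻¹ := by
    have hp1 : (1 : ℝ) < p := by exact_mod_cast hp.one_lt
    refine inv_nonneg.2 (tprod_nonneg fun i => ?_)
    exact sub_nonneg.2 (pow_le_one₀ (by positivity) (inv_lt_one_of_one_lt₀ hp1).le)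
  rw [ENNReal.toReal_ofReal h0, ENNReal.tsum_toReal_eq] at h
  · rw [← h]
    refine tsum_congr fun π => ?_
    simp
  · intro π
    have := CL.aut_finite p hp π
    refine ENNReal.inv_ne_top.2 ?_
    exact_mod_cast Nat.card_pos.ne'
end

section
/- The number of maximal unlinked sets in F_p^{2k} with respect to Φ_k equals N(k+1,p) - N(k,p), where N(m,p) is the total number of F_p-subspaces of F_p^m. -/
open Finset

/-- `Φ_k(u,v) = ∑ i, u_{i1} (v_{i2} - u_{i2})` on `𝔽_p^{2k}`, realized as
`Fin k → ZMod p × ZMod p` (first component = odd coordinate, second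
component = even coordinate). -/
def Phik (p k : ℕ) (u v : Fin k → ZMod p × ZMod p) : ZMod p :=
  ∑ i, (u i).1 * ((v i).2 - (u i).2)

/-- A set is unlinked if `Φ_k` vanishes on all ordered pairs from it. -/
def Unlinked (p k : ℕ) (U : Set (Fin k → ZMod p × ZMod p)) : Prop :=
  ∀ u ∈ U, ∀ v ∈ U, Phik p k u v = 0

/-- A maximal unlinked set: unlinked and not properly contained in any other
unlinked set. -/
def MaximalUnlinked (p k : ℕ) (U : Set (Fin k → ZMod p × ZMod p)) : Prop :=
  Unlinked p k U ∧ ∀ U', Unlinked p k U' → U ⊆ U' → U' = U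

namespace UnlinkedAux

variable {p k : ℕ}

/-- Embedding of `F^k` as the hyperplane `x 0 = 0`. -/
def iota (p k : ℕ) : (Fin k → ZMod p) →ₗ[ZMod p] (Fin (k + 1) → ZMod p) where
  toFun w := Fin.cons 0 w
  map_add' x y := by
    funext i; refine Fin.cases ?_ (fun j => ?_) i <;> simp
  map_smul' c x := by
    funext i; refine Fin.cases ?_ (fun j => ?_) i <;> simp

lemma iota_inj : Function.Injective (iota p k) := by
  intro x y h
  funext j
  have := congrFun h j.succ
  simpa [iota] using this

lemma mem_range_iota (x : Fin (k + 1) → ZMod p) :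
    x ∈ LinearMap.range (iota p k) ↔ x 0 = 0 := by
  constructor
  · rintro ⟨w, rfl⟩; simp [iota]
  · intro h
    refine ⟨Fin.tail x, ?_⟩
    funext i; refine Fin.cases ?_ (fun j => ?_) i
    · simp [iota, h]
    · simp [iota, Fin.tail]

/-- The point `(1, b)`. -/
def aff (b : Fin k → ZMod p) : Fin (k + 1) → ZMod p := Fin.cons 1 b

lemma aff_add (b w : Fin k → ZMod p) : aff (b + w) = aff b + iota p k w := by
  funext i; refine Fin.cases ?_ (fun j => ?_) i <;> simp [aff, iota]

lemma eq_aff (x : Fin (k + 1) → ZMod p) (h : x 0 = 1) : x = aff (Fin.tail x) := by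
  funext i; refine Fin.cases ?_ (fun j => ?_) i <;> simp [aff, Fin.tail, h]

/-- The unlinked set attached to a subspace. -/
def US (S : Submodule (ZMod p) (Fin (k + 1) → ZMod p)) : Set (Fin k → ZMod p × ZMod p) :=
  {u | aff (fun i => (u i).2) ∈ S ∧ ∀ w, iota p k w ∈ S → ∑ i, (u i).1 * w i = 0}

lemma aff_sub_mem {S : Submodule (ZMod p) (Fin (k + 1) → ZMod p)} {b c : Fin k → ZMod p}
    (hb : aff b ∈ S) (hc : aff c ∈ S) : iota p k (c - b) ∈ S := by
  have h := aff_add b (c - b)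
  rw [add_sub_cancel] at h
  have : iota p k (c - b) = aff c - aff b := by rw [h]; abel
  rw [this]; exact S.sub_mem hc hb

lemma US_unlinked (S : Submodule (ZMod p) (Fin (k + 1) → ZMod p)) : Unlinked p k (US S) := by
  intro u hu v hv
  exact hu.2 _ (aff_sub_mem hu.1 hv.1)

lemma exists_aff [Fact p.Prime] {S : Submodule (ZMod p) (Fin (k + 1) → ZMod p)}
    (hS : ¬ S ≤ LinearMap.range (iota p k)) : ∃ b, aff b ∈ S := by
  obtain ⟨x, hx, hx0⟩ := SetLike.not_le_iff_exists.mp hS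
  rw [mem_range_iota] at hx0
  refine ⟨Fin.tail ((x 0)⁻¹ • x), ?_⟩
  rw [← eq_aff]
  · exact S.smul_mem _ hx
  · simp [hx0]

lemma double_perp [Fact p.Prime] (W : Submodule (ZMod p) (Fin k → ZMod p)) (x : Fin k → ZMod p)
    (h : ∀ a : Fin k → ZMod p, (∀ w ∈ W, ∑ i, a i * w i = 0) → ∑ i, a i * x i = 0) : x ∈ W := by
  by_contra hx
  obtain ⟨f, hf, hW⟩ := Submodule.exists_le_ker_of_notMem hx
  have key : ∀ y, ∑ i, f (Pi.single i 1) * y i = f y := by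
    intro y
    rw [LinearMap.pi_apply_eq_sum_univ f y]
    refine Finset.sum_congr rfl fun i _ => ?_
    rw [smul_eq_mul, mul_comm]
    congr 2
    funext j
    simp [Pi.single_apply, eq_comm]
  refine hf ?_
  rw [← key]
  refine h _ fun w hw => ?_
  rw [key]
  exact hW hw

lemma US_maximal [Fact p.Prime] {S : Submodule (ZMod p) (Fin (k + 1) → ZMod p)}
    (hS : ¬ S ≤ LinearMap.range (iota p k)) : MaximalUnlinked p k (US S) := by
  refine ⟨US_unlinked S, fun U' hU' hsub => Set.Subset.antisymm ?_ hsub⟩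
  obtain ⟨b, hb⟩ := exists_aff hS
  intro u hu
  constructor
  · have : (fun i => (u i).2) - b ∈ S.comap (iota p k) := by
      refine double_perp _ _ fun a ha => ?_
      have hm : (fun i => (a i, b i)) ∈ US S := ⟨hb, fun w hw => ha w hw⟩
      exact hU' _ (hsub hm) _ hu
    have h2 := aff_add b ((fun i => (u i).2) - b)
    rw [add_sub_cancel] at h2
    rw [h2]
    exact S.add_mem hb this
  · intro w hw
    have h1 : (fun i => ((0 : ZMod p), b i)) ∈ US S := ⟨hb, fun w hw => by simp⟩
    have h2 : (fun i => ((0 : ZMod p), (b + w) i)) ∈ US S :=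
      ⟨by
        change aff (b + w) ∈ S
        rw [aff_add]; exact S.add_mem hb hw, fun w hw => by simp⟩
    have e1 := hU' _ hu _ (hsub h1)
    have e2 := hU' _ hu _ (hsub h2)
    unfold Phik at e1 e2
    have e3 := sub_eq_zero.2 (e2.trans e1.symm)
    rw [← Finset.sum_sub_distrib] at e3
    rw [← e3]
    refine Finset.sum_congr rfl fun i _ => ?_
    simp only [Pi.add_apply]; ring

lemma le_of_US_eq [Fact p.Prime] {S T : Submodule (ZMod p) (Fin (k + 1) → ZMod p)}
    (hS : ¬ S ≤ LinearMap.range (iota p k)) (h : US S = US T) : S ≤ T := by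
  have haff : ∀ b, aff b ∈ S → aff b ∈ T := by
    intro b hb
    have h1 : (fun i => ((0 : ZMod p), b i)) ∈ US S := ⟨hb, fun w hw => by simp⟩
    rw [h] at h1
    exact h1.1
  obtain ⟨b, hb⟩ := exists_aff hS
  intro x hx
  by_cases h0 : x 0 = 0
  · obtain ⟨w, rfl⟩ := (mem_range_iota x).2 h0
    have h1 := haff (b + w) (by rw [aff_add]; exact S.add_mem hb hx)
    have := aff_sub_mem (haff b hb) h1
    simpa using this
  · have h1 := haff (Fin.tail ((x 0)⁻¹ • x)) (by
      rw [← eq_aff]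
      · exact S.smul_mem _ hx
      · simp [h0])
    rw [← eq_aff _ (by simp [h0])] at h1
    have := T.smul_mem (x 0) h1
    rwa [smul_inv_smul₀ h0] at this

lemma US_surj {U : Set (Fin k → ZMod p × ZMod p)} [Fact p.Prime] (hU : MaximalUnlinked p k U) :
    ∃ S : Submodule (ZMod p) (Fin (k + 1) → ZMod p),
      ¬ S ≤ LinearMap.range (iota p k) ∧ US S = U := by
  have hne : U.Nonempty := by
    by_contra hE
    rw [Set.not_nonempty_iff_eq_empty] at hE
    have := hU.2 {0} (by rintro u rfl v rfl; simp [Phik]) (by simp [hE])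
    rw [hE] at this
    simp at this
  let S := Submodule.span (ZMod p)
    ((fun u : Fin k → ZMod p × ZMod p => aff (fun i => (u i).2)) '' U)
  have hmem : ∀ u ∈ U, aff (fun i => (u i).2) ∈ S := fun u hu =>
    Submodule.subset_span ⟨u, hu, rfl⟩
  refine ⟨S, ?_, ?_⟩
  · intro hle
    obtain ⟨u, hu⟩ := hne
    have := (mem_range_iota _).1 (hle (hmem u hu))
    simp [aff] at this
  · refine hU.2 _ (US_unlinked S) fun u hu => ⟨hmem u hu, ?_⟩
    have key : ∀ x ∈ S, ∑ i, (u i).1 * (x i.succ - x 0 * (u i).2) = 0 := by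
      intro x hx
      induction hx using Submodule.span_induction with
      | mem x hx =>
        obtain ⟨v, hv, rfl⟩ := hx
        simpa [aff, Phik] using hU.1 u hu v hv
      | zero => simp
      | add x y _ _ hx hy =>
        rw [← add_zero (0 : ZMod p)]
        nth_rewrite 1 [← hx]
        rw [← hy, ← Finset.sum_add_distrib]
        refine Finset.sum_congr rfl fun i _ => ?_
        simp only [Pi.add_apply]; ring
      | smul c x _ hx =>
        rw [← mul_zero c, ← hx, Finset.mul_sum]
        refine Finset.sum_congr rfl fun i _ => ?_
        simp only [Pi.smul_apply, smul_eq_mul]; ring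
    intro w hw
    simpa [iota] using key _ hw

/-- Subspaces of the hyperplane are subspaces of `F^k`. -/
def hypEquiv (p k : ℕ) : {S : Submodule (ZMod p) (Fin (k + 1) → ZMod p) //
    S ≤ LinearMap.range (iota p k)} ≃ Submodule (ZMod p) (Fin k → ZMod p) where
  toFun S := S.1.comap (iota p k)
  invFun W := ⟨W.map (iota p k), LinearMap.map_le_range⟩
  left_inv S := by
    ext1
    exact Submodule.map_comap_eq_self S.2
  right_inv W := Submodule.comap_map_eq_of_injective iota_inj W

end UnlinkedAux

open UnlinkedAux in
/-- The number of maximal unlinked sets in `𝔽_p^{2k}` equals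
`N(k+1,p) - N(k,p)`, where `N(m,p)` is the number of all subspaces of
`𝔽_p^m`. -/
theorem card_maximalUnlinked_sets (p k : ℕ) (hp : p.Prime) (hk : 1 ≤ k) :
    Nat.card {U : Set (Fin k → ZMod p × ZMod p) // MaximalUnlinked p k U} =
      Nat.card (Submodule (ZMod p) (Fin (k + 1) → ZMod p)) -
        Nat.card (Submodule (ZMod p) (Fin k → ZMod p)) := by
  haveI : Fact p.Prime := ⟨hp⟩
  classical
  have h1 : Nat.card {S : Submodule (ZMod p) (Fin (k + 1) → ZMod p) //
      ¬ S ≤ LinearMap.range (iota p k)} =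
      Nat.card {U : Set (Fin k → ZMod p × ZMod p) // MaximalUnlinked p k U} := by
    refine Nat.card_eq_of_bijective (fun S => ⟨US S.1, US_maximal S.2⟩) ⟨?_, ?_⟩
    · intro S T h
      have h' : US S.1 = US T.1 := congrArg Subtype.val h
      exact Subtype.ext (le_antisymm (le_of_US_eq S.2 h') (le_of_US_eq T.2 h'.symm))
    · rintro ⟨U, hU⟩
      obtain ⟨S, hS, h⟩ := US_surj hU
      exact ⟨⟨S, hS⟩, Subtype.ext h⟩
  have h2 := Nat.card_congr (hypEquiv p k)
  have h3 := Nat.card_congr (Equiv.sumCompl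
    (fun S : Submodule (ZMod p) (Fin (k + 1) → ZMod p) => S ≤ LinearMap.range (iota p k)))
  rw [Nat.card_sum] at h3
  omega
end
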